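/- Let a, b, c ∈ ℝ satisfy c > −2n and −2a < −n < 2(b+1) (i.e. a > n/2 and b + 1 > −n/2). Then there is a constant C = C(n,a,b,c) such that for every measurable function h : B_n → [0,∞], ‖T_{a,b,c} h‖_{CM} ≤ C ‖h‖_{CM}, where T_{a,b,c} h(z) = ∫_{B_n} (1−|z|²)^a (1−|w|²)^b (√△(w,z))^c |1−⟨z,w⟩|^{−(n+1+a+b+c)} h(w) dV(w). -/

import Mathlib

open MeasureTheory Metric Set Complex Topology
open scoped ENNReal NNReal

noncomputable section

/-- `ℂⁿ` with the Euclidean (Hermitian) norm: the ball `B_n` is `Metric.ball 0 1`. -/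
abbrev En (n : ℕ) : Type := EuclideanSpace ℂ (Fin n)

instance (n : ℕ) : MeasurableSpace (En n) := borel _
instance (n : ℕ) : BorelSpace (En n) := ⟨rfl⟩

/-- The Hilbert space `ℓ²` of square-summable complex sequences. -/
abbrev l2 : Type := lp (fun _ : ℕ => ℂ) 2

/-- The pairing `⟨z,w⟩ = ∑_j z_j conj (w_j)`. -/
def herm {n : ℕ} (z w : En n) : ℂ := ∑ j, z j * (starRingEnd ℂ) (w j)

/-- The Carleson tent `S_ζ`. -/
def tent {n : ℕ} (ζ : En n) : Set (En n) :=
  {z ∈ ball (0 : En n) 1 | 1 / 2 < (1 - ‖ζ‖) / ‖1 - herm z ζ‖}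

/-- The measure `λ_n` on `B_n`, `dλ_n(z) = (1-|z|²)^{-n-1} dV(z)`. -/
def lambdaM (n : ℕ) : Measure (En n) :=
  ((volume : Measure (En n)).restrict (ball (0 : En n) 1)).withDensity
    fun z => ENNReal.ofReal ((1 - ‖z‖ ^ 2) ^ (-(n : ℝ) - 1))

/-- The normalized rotation-invariant surface measure `σ` on the unit sphere `∂B_n`. -/
def sphereM (n : ℕ) : Measure (sphere (0 : En n) 1) :=
  (((volume : Measure (En n)).toSphere) Set.univ)⁻¹ • ((volume : Measure (En n)).toSphere)

/-- The squared Hilbert–Schmidt norm of the holomorphic derivative `f′(z) = (∂f_i/∂z_j)`. -/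
def hsSq {n : ℕ} (f : En n → l2) (z : En n) : ℝ :=
  ∑' i : ℕ, ∑ j, ‖(fderiv ℂ f z (EuclideanSpace.single j 1)) i‖ ^ 2

/-- The squared Carleson-measure norm `‖g‖_CM²` of a scalar function on the ball. -/
def cmSq {n : ℕ} (g : En n → ℝ) : ℝ≥0∞ :=
  ⨆ (ζ : En n) (_ : ζ ∈ ball (0 : En n) 1 \ {0}),
    (ENNReal.ofReal ((1 - ‖ζ‖) ^ n))⁻¹ *
      ∫⁻ z in tent ζ, ENNReal.ofReal ((g z) ^ 2) ∂(lambdaM n)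

/-- `△(w,z) = |1-⟨w,z⟩|² - (1-|w|²)(1-|z|²)`. -/
def trid {n : ℕ} (w z : En n) : ℝ :=
  ‖1 - herm w z‖ ^ 2 - (1 - ‖w‖ ^ 2) * (1 - ‖z‖ ^ 2)

/-- The positive operator `T_{a,b,c}` acting on nonnegative functions on the ball. -/
def Tabc {n : ℕ} (a b c : ℝ) (h : En n → ℝ≥0∞) (z : En n) : ℝ≥0∞ :=
  ∫⁻ w in ball (0 : En n) 1,
    ENNReal.ofReal
      ((1 - ‖z‖ ^ 2) ^ a * (1 - ‖w‖ ^ 2) ^ b * Real.sqrt (trid w z) ^ c *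
        ‖1 - herm z w‖ ^ (-((n : ℝ) + 1 + a + b + c))) * h w ∂volume

/-- The squared Carleson-measure norm of an `ℝ≥0∞`-valued function on the ball. -/
def cmSqE {n : ℕ} (g : En n → ℝ≥0∞) : ℝ≥0∞ :=
  ⨆ (ζ : En n) (_ : ζ ∈ ball (0 : En n) 1 \ {0}),
    (ENNReal.ofReal ((1 - ‖ζ‖) ^ n))⁻¹ * ∫⁻ z in tent ζ, (g z) ^ 2 ∂(lambdaM n)


theorem herm_eq_inner {n : ℕ} (z w : En n) : herm z w = inner ℂ w z := by
  simp [herm, PiLp.inner_apply]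

theorem norm_herm_comm {n : ℕ} (z w : En n) : ‖1 - herm z w‖ = ‖1 - herm w z‖ := by
  have : herm w z = (starRingEnd ℂ) (herm z w) := by
    rw [herm_eq_inner, herm_eq_inner, inner_conj_symm]
  rw [this, ← RCLike.norm_conj]; simp

theorem exists_unit {n : ℕ} (hn : 1 ≤ n) (w : En n) :
    ∃ u : En n, ‖u‖ = 1 ∧ ∀ z, herm z w = (‖w‖ : ℂ) * herm z u := by
  by_cases hw : w = 0
  · refine ⟨EuclideanSpace.single ⟨0, hn⟩ 1, by simp, fun z => ?_⟩
    subst hw; simp [herm]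
  · refine ⟨((‖w‖⁻¹ : ℝ) : ℂ) • w, ?_, fun z => ?_⟩
    · rw [norm_smul]; simp [hw]
    · rw [herm_eq_inner, herm_eq_inner, inner_smul_left]
      have : (‖w‖ : ℂ) ≠ 0 := by simpa using hw
      simp; field_simp

theorem box_vol (n : ℕ) (hn : 1 ≤ n) : ∃ C : ℝ, 0 < C ∧ ∀ u : En n, ‖u‖ = 1 →
    ∀ (p : ℂ) (r s : ℝ), 0 < r → 0 < s →
      volume {z : En n | ‖p - herm z u‖ < r ∧ ‖z‖ ^ 2 - ‖herm z u‖ ^ 2 < s} ≤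
        ENNReal.ofReal (C * (r ^ 2 * s ^ (n - 1))) := by
  obtain ⟨m, rfl⟩ : ∃ m, n = m + 1 := ⟨n - 1, by omega⟩
  let e : En (m+1) ≃L[ℝ] (Fin (m+1) → ℂ) :=
    PiLp.continuousLinearEquiv 2 ℝ (fun _ : Fin (m+1) => ℂ)
  let ν : Measure (Fin (m+1) → ℂ) := (volume : Measure (En (m+1))).map e
  have : ν.IsAddHaarMeasure := e.isAddHaarMeasure_map volume
  have hν := Measure.isAddLeftInvariant_eq_smul ν (volume : Measure (Fin (m+1) → ℂ))
  set k0 := Measure.addHaarScalarFactor ν (volume : Measure (Fin (m+1) → ℂ)) with hk0d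
  have hk0' : 0 < k0 := Measure.addHaarScalarFactor_pos_of_isAddHaarMeasure _ _
  obtain ⟨k, hk0, hkt, hk⟩ : ∃ k : ℝ≥0∞, k ≠ 0 ∧ k ≠ ⊤ ∧
      ν = k • (volume : Measure (Fin (m+1) → ℂ)) :=
    ⟨k0, by exact_mod_cast hk0'.ne', by simp, hν⟩
  refine ⟨k.toReal * Real.pi ^ (m+1), by
    have := ENNReal.toReal_pos hk0 hkt
    positivity, ?_⟩
  intro u hu p r s hr hs
  obtain ⟨b, hb⟩ : ∃ b : OrthonormalBasis (Fin (m+1)) ℂ (En (m+1)), b 0 = u := by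
    have h1 : Orthonormal ℂ (({0} : Set (Fin (m+1))).domRestrict (fun _ => u)) := by
      constructor
      · intro i; exact hu
      · intro i j hij; exact absurd (Subsingleton.elim i j) hij
    obtain ⟨b, hb⟩ := h1.exists_orthonormalBasis_extension_of_card_eq (by simp)
    exact ⟨b, hb 0 (by simp)⟩
  let U : En (m+1) ≃ₗᵢ[ℝ] En (m+1) :=
    { (b.repr.toLinearEquiv.restrictScalars ℝ) with norm_map' := fun x => b.repr.norm_map x }
  have hU : MeasurePreserving U volume volume := U.measurePreserving
  let R : Fin (m+1) → ℝ := Fin.cons r (fun _ => √s)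
  let c : Fin (m+1) → ℂ := Fin.cons p (fun _ => 0)
  have hRpos : ∀ i, 0 < R i := by
    intro i; refine Fin.cases ?_ (fun j => ?_) i
    · simpa [R] using hr
    · simpa [R] using hs
  have hsub : {z : En (m+1) | ‖p - herm z u‖ < r ∧ ‖z‖ ^ 2 - ‖herm z u‖ ^ 2 < s} ⊆
      U ⁻¹' (e ⁻¹' (Set.univ.pi fun i => ball (c i) (R i))) := by
    rintro z ⟨h1, h2⟩
    have hz0 : (b.repr z) 0 = herm z u := by
      rw [b.repr_apply_apply, hb, herm_eq_inner]
    have hzn : ‖z‖ ^ 2 = ‖herm z u‖ ^ 2 + ∑ j : Fin m, ‖(b.repr z) j.succ‖ ^ 2 := by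
      rw [← b.repr.norm_map z, EuclideanSpace.norm_sq_eq, Fin.sum_univ_succ, hz0]
    intro i _
    change (b.repr z) i ∈ ball (c i) (R i)
    refine Fin.cases ?_ (fun j => ?_) i
    · simp only [c, R, Fin.cons_zero, mem_ball, hz0, dist_eq_norm]
      rwa [norm_sub_rev]
    · simp only [c, R, Fin.cons_succ, mem_ball, dist_zero_right]
      apply Real.lt_sqrt_of_sq_lt
      have := Finset.single_le_sum (f := fun j : Fin m => ‖(b.repr z) j.succ‖ ^ 2)
        (fun _ _ => by positivity) (Finset.mem_univ j)
      simp only at this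
      linarith
  refine (measure_mono hsub).trans ?_
  have hmeas : MeasurableSet (Set.univ.pi fun i => ball (c i) (R i)) :=
    MeasurableSet.univ_pi fun i => measurableSet_ball
  rw [hU.measure_preimage (e.continuous.measurable hmeas).nullMeasurableSet,
    ← Measure.map_apply e.continuous.measurable hmeas]
  change ν _ ≤ _
  rw [hk, Measure.smul_apply, volume_pi_pi, smul_eq_mul]
  simp only [Complex.volume_ball]
  have : ∀ i, ENNReal.ofReal (R i) ^ 2 * (NNReal.pi : ℝ≥0∞) = ENNReal.ofReal (R i ^ 2 * Real.pi) := by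
    intro i
    rw [ENNReal.ofReal_mul (by positivity), ENNReal.ofReal_pow (hRpos i).le]
    congr 1
    rw [← NNReal.coe_real_pi, ENNReal.ofReal_coe_nnreal]
  simp only [this]
  rw [← ENNReal.ofReal_prod_of_nonneg (fun i _ => by have := Real.pi_pos; positivity),
    ← ENNReal.ofReal_toReal hkt, ← ENNReal.ofReal_mul (by positivity)]
  apply ENNReal.ofReal_le_ofReal
  rw [Fin.prod_univ_succ]
  simp only [R, Fin.cons_zero, Fin.cons_succ, Finset.prod_const, Finset.card_univ, Fintype.card_fin,
    Real.sq_sqrt hs.le, ENNReal.toReal_ofReal ENNReal.toReal_nonneg]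
  simp only [Nat.add_sub_cancel]
  apply le_of_eq; ring

theorem lintegral_le_geom {α : Type*} [MeasurableSpace α] (μ : Measure α) (f : α → ℝ≥0∞)
    (S : ℕ → Set α) (hS : ∀ k, MeasurableSet (S k)) (a b : ℕ → ℝ) (A : ℝ≥0∞) (B q : ℝ)
    (ha : ∀ k, 0 ≤ a k) (hB : 0 ≤ B) (hq0 : 0 ≤ q) (hq1 : q < 1)
    (hf : ∀ᵐ x ∂μ, ∃ k, x ∈ S k ∧ f x ≤ ENNReal.ofReal (a k))
    (hμ : ∀ k, μ (S k) ≤ A * ENNReal.ofReal (b k))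
    (hab : ∀ k, a k * b k = B * q ^ k) :
    ∫⁻ x, f x ∂μ ≤ A * ENNReal.ofReal (B / (1 - q)) := by
  calc ∫⁻ x, f x ∂μ ≤ ∫⁻ x, ∑' k, (S k).indicator (fun _ => ENNReal.ofReal (a k)) x ∂μ := by
        apply lintegral_mono_ae
        filter_upwards [hf] with x ⟨k, hk, hfk⟩
        refine le_trans ?_ (ENNReal.le_tsum k)
        simpa [hk] using hfk
    _ = ∑' k, ∫⁻ x, (S k).indicator (fun _ => ENNReal.ofReal (a k)) x ∂μ :=
        lintegral_tsum fun k => (measurable_const.indicator (hS k)).aemeasurable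
    _ ≤ ∑' k, A * ENNReal.ofReal (B * q ^ k) := by
        apply ENNReal.tsum_le_tsum
        intro k
        rw [lintegral_indicator_const (hS k), ← hab, ENNReal.ofReal_mul (ha k)]
        calc _ ≤ ENNReal.ofReal (a k) * (A * ENNReal.ofReal (b k)) := by gcongr; exact hμ k
          _ = _ := by ring
    _ = A * ENNReal.ofReal (B / (1 - q)) := by
        rw [ENNReal.tsum_mul_left]
        congr 1
        rw [← ENNReal.ofReal_tsum_of_nonneg (fun k => by positivity)
          ((summable_geometric_of_lt_one hq0 hq1).mul_left B), tsum_mul_left,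
          tsum_geometric_of_lt_one hq0 hq1, div_eq_mul_inv]

theorem dyadic_up {α : Type*} [MeasurableSpace α] (μ : Measure α) (X : α → ℝ)
    (hX : Measurable X) {δ m q : ℝ} (hδ : 0 < δ) (hmq : m < q) (hq : 0 ≤ q) (A : ℝ≥0∞)
    (hge : ∀ᵐ x ∂μ, δ ≤ X x)
    (hA : ∀ r, δ ≤ r → μ {x | X x < r} ≤ A * ENNReal.ofReal (r ^ m)) :
    ∫⁻ x, ENNReal.ofReal ((X x) ^ (-q)) ∂μ ≤
      A * ENNReal.ofReal ((2:ℝ) ^ m / (1 - (2:ℝ) ^ (m - q)) * δ ^ (m - q)) := by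
  have h1 : (2:ℝ) ^ (m - q) < 1 := Real.rpow_lt_one_of_one_lt_of_neg (by norm_num) (by linarith)
  have := lintegral_le_geom μ (fun x => ENNReal.ofReal ((X x) ^ (-q)))
    (fun k => {x | X x < 2 ^ (k+1) * δ}) (fun k => measurableSet_lt hX measurable_const)
    (fun k => (2 ^ k * δ) ^ (-q)) (fun k => (2 ^ (k+1) * δ) ^ m) A ((2:ℝ) ^ m * δ ^ (m - q))
    ((2:ℝ) ^ (m - q)) (fun k => by positivity) (by positivity) (by positivity) h1 ?_ ?_ ?_
  · convert this using 3
    ring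
  · filter_upwards [hge] with x hx
    obtain ⟨k, hk1, hk2⟩ := exists_nat_pow_near (x := X x / δ) (y := 2)
      ((one_le_div hδ).2 hx) (by norm_num)
    rw [le_div_iff₀ hδ] at hk1
    rw [div_lt_iff₀ hδ] at hk2
    refine ⟨k, hk2, ENNReal.ofReal_le_ofReal ?_⟩
    exact Real.rpow_le_rpow_of_nonpos (by positivity) hk1 (by linarith)
  · intro k
    apply hA
    have : (1:ℝ) ≤ 2 ^ (k+1) := one_le_pow₀ (by norm_num)
    nlinarith
  · intro k
    rw [Real.mul_rpow (by positivity) hδ.le, Real.mul_rpow (by positivity) hδ.le,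
      pow_succ, Real.mul_rpow (by positivity) (by norm_num), ← Real.rpow_natCast,
      ← Real.rpow_natCast, ← Real.rpow_mul (by norm_num), ← Real.rpow_mul (by norm_num),
      ← Real.rpow_mul (by norm_num), sub_eq_add_neg, Real.rpow_add hδ,
      show (m + -q) * (k:ℝ) = k * -q + k * m by ring, Real.rpow_add (by norm_num)]
    ring

theorem dyadic_down {α : Type*} [MeasurableSpace α] (μ : Measure α) (Y : α → ℝ)
    (hY : Measurable Y) {R m c : ℝ} (hR : 0 < R) (hmc : 0 < m + c) (hc : c < 0) (A : ℝ≥0∞)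
    (hle : ∀ᵐ x ∂μ, 0 ≤ Y x ∧ Y x ≤ R)
    (hA : ∀ r, 0 < r → μ {x | Y x < r} ≤ A * ENNReal.ofReal (r ^ m)) :
    ∫⁻ x, ENNReal.ofReal ((Y x) ^ c) ∂μ ≤
      A * ENNReal.ofReal ((2:ℝ) ^ (m - c) / (1 - (2:ℝ) ^ (-(m + c))) * R ^ (m + c)) := by
  have h1 : (2:ℝ) ^ (-(m + c)) < 1 :=
    Real.rpow_lt_one_of_one_lt_of_neg (by norm_num) (by linarith)
  have := lintegral_le_geom μ (fun x => ENNReal.ofReal ((Y x) ^ c))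
    (fun k => {x | Y x < 2 * ((1/2) ^ k * R)}) (fun k => measurableSet_lt hY measurable_const)
    (fun k => ((1/2) ^ (k+1) * R) ^ c) (fun k => (2 * ((1/2) ^ k * R)) ^ m) A
    ((2:ℝ) ^ (m - c) * R ^ (m + c))
    ((2:ℝ) ^ (-(m + c))) (fun k => by positivity) (by positivity) (by positivity) h1 ?_ ?_ ?_
  · convert this using 3
    ring
  · filter_upwards [hle] with x hx
    rcases hx.1.eq_or_lt with h0 | h0
    · refine ⟨0, ?_, ?_⟩
      · rw [← h0]; positivity
      · rw [← h0, Real.zero_rpow hc.ne]; simp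
    obtain ⟨k, hk1, hk2⟩ := exists_nat_pow_near_of_lt_one (x := Y x / R) (y := 1/2)
      (by positivity) ((div_le_one hR).2 hx.2) (by norm_num) (by norm_num)
    rw [lt_div_iff₀ hR] at hk1
    rw [div_le_iff₀ hR] at hk2
    refine ⟨k, ?_, ENNReal.ofReal_le_ofReal ?_⟩
    · linarith
    · exact Real.rpow_le_rpow_of_nonpos (by positivity) hk1.le hc.le
  · intro k
    exact hA _ (by positivity)
  · intro k
    have e1 : ((1:ℝ)/2) ^ k = (2:ℝ) ^ (-(k:ℝ)) := by
      rw [Real.rpow_neg (by norm_num), Real.rpow_natCast]; simp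
    have e2 : ((1:ℝ)/2) ^ (k+1) = (2:ℝ) ^ (-(k:ℝ) - 1) := by
      rw [pow_succ, e1, Real.rpow_sub (by norm_num)]; simp; ring
    rw [e1, e2, Real.mul_rpow (by positivity) hR.le, Real.mul_rpow (by positivity) (by positivity),
      Real.mul_rpow (by positivity) hR.le, ← Real.rpow_natCast, 
      ← Real.rpow_mul (by norm_num), ← Real.rpow_mul (by norm_num),
      ← Real.rpow_mul (by norm_num), Real.rpow_add hR]
    have : (2:ℝ) ^ ((-(k:ℝ) - 1) * c) * ((2:ℝ) ^ m * (2:ℝ) ^ (-(k:ℝ) * m)) =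
        (2:ℝ) ^ (m - c) * (2:ℝ) ^ (-(m + c) * k) := by
      rw [← Real.rpow_add (by norm_num), ← Real.rpow_add (by norm_num), ← Real.rpow_add (by norm_num)]
      congr 1; ring
    calc _ = ((2:ℝ) ^ ((-(k:ℝ) - 1) * c) * ((2:ℝ) ^ m * (2:ℝ) ^ (-(k:ℝ) * m))) * (R ^ m * R ^ c) := by ring
      _ = _ := by rw [this]; ring

section pointwise
variable {n : ℕ}

theorem norm_herm_le (z w : En n) : ‖herm z w‖ ≤ ‖z‖ * ‖w‖ := by
  rw [herm_eq_inner, mul_comm]; exact norm_inner_le_norm _ _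

theorem one_sub_norm_le {z w : En n} (hz : ‖z‖ < 1) : 1 - ‖w‖ ≤ ‖1 - herm z w‖ := by
  have h1 : ‖(1:ℂ)‖ - ‖herm z w‖ ≤ ‖1 - herm z w‖ := norm_sub_norm_le _ _
  have h2 := norm_herm_le z w
  have h3 : ‖z‖ * ‖w‖ ≤ 1 * ‖w‖ := by gcongr
  simp at h1; linarith

theorem one_sub_sq_le {z w : En n} (hz : ‖z‖ < 1) (hw : ‖w‖ < 1) :
    1 - ‖w‖ ^ 2 ≤ 2 * ‖1 - herm z w‖ := by
  have := one_sub_norm_le (w := w) hz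
  have := norm_nonneg w
  nlinarith

theorem one_sub_sq_le' {z w : En n} (hz : ‖z‖ < 1) (hw : ‖w‖ < 1) :
    1 - ‖z‖ ^ 2 ≤ 2 * ‖1 - herm z w‖ := by
  rw [norm_herm_comm]; exact one_sub_sq_le hw hz

theorem one_sub_sq_pos {w : En n} (hw : ‖w‖ < 1) : 0 < 1 - ‖w‖ ^ 2 := by
  have := norm_nonneg w
  nlinarith

theorem X_pos {z w : En n} (hz : ‖z‖ < 1) (hw : ‖w‖ < 1) : 0 < ‖1 - herm z w‖ := by
  have := one_sub_norm_le (w := w) hz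
  linarith

theorem trid_comm (z w : En n) : trid z w = trid w z := by
  unfold trid; rw [norm_herm_comm]; ring

theorem trid_formula {w u : En n} (hu : ∀ z, herm z w = (‖w‖ : ℂ) * herm z u) (z : En n) :
    trid z w = ‖(‖w‖ : ℂ) - herm z u‖ ^ 2 + (1 - ‖w‖ ^ 2) * (‖z‖ ^ 2 - ‖herm z u‖ ^ 2) := by
  unfold trid
  rw [hu z]
  generalize herm z u = x
  rw [Complex.sq_norm, Complex.sq_norm, Complex.sq_norm, Complex.normSq_apply, Complex.normSq_apply,
    Complex.normSq_apply]
  simp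
  ring

theorem trid_nonneg (hn : 1 ≤ n) {w : En n} (hw : ‖w‖ < 1) (z : En n) : 0 ≤ trid z w := by
  obtain ⟨u, hu1, hu⟩ := exists_unit hn w
  rw [trid_formula hu]
  have h := norm_herm_le z u
  rw [hu1, mul_one] at h
  have h2 : ‖herm z u‖ ^ 2 ≤ ‖z‖ ^ 2 := by gcongr
  have := one_sub_sq_pos hw
  have : 0 ≤ (1 - ‖w‖ ^ 2) * (‖z‖ ^ 2 - ‖herm z u‖ ^ 2) := mul_nonneg this.le (by linarith)
  positivity

theorem trid_le {z w : En n} (hz : ‖z‖ < 1) (hw : ‖w‖ < 1) : trid z w ≤ ‖1 - herm z w‖ ^ 2 := by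
  unfold trid
  have := mul_pos (one_sub_sq_pos hz) (one_sub_sq_pos hw)
  linarith

theorem quasi_triangle {w z ζ : En n} (hw : ‖w‖ < 1) (hz : ‖z‖ < 1) (hζ : ‖ζ‖ < 1) :
    ‖1 - herm w ζ‖ ≤ 2 * ‖1 - herm z w‖ + 4 * ‖1 - herm z ζ‖ := by
  have key : ∀ x y : En n, ‖x‖ < 1 → ‖y‖ < 1 → ‖x - y‖ ^ 2 ≤ 2 * ‖1 - herm x y‖ := by
    intro x y hx hy
    have h1 := norm_sub_sq (𝕜 := ℂ) y x
    rw [← herm_eq_inner x y, norm_sub_rev] at h1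
    have h2 : (1 - herm x y).re ≤ ‖1 - herm x y‖ := Complex.re_le_norm _
    have h3 := one_sub_sq_pos hx
    have h4 := one_sub_sq_pos hy
    simp at h1 h2
    linarith
  have e : 1 - herm w ζ = (1 - herm w z) + inner ℂ (z - ζ) (w - z) +
      ((1 - herm z ζ) - (1 - (‖z‖:ℂ) ^ 2)) := by
    simp only [herm_eq_inner, inner_sub_left, inner_sub_right]
    rw [inner_self_eq_norm_sq_to_K]
    simp
    ring
  have h1 : ‖inner ℂ (z - ζ) (w - z)‖ ≤ ‖z - ζ‖ * ‖w - z‖ := norm_inner_le_norm _ _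
  have h2 := key z ζ hz hζ
  have h3 := key w z hw hz
  rw [norm_herm_comm w z] at h3
  have h4 : ‖(1 : ℂ) - (‖z‖:ℂ) ^ 2‖ ≤ 2 * ‖1 - herm z ζ‖ := by
    have : (1 : ℂ) - (‖z‖:ℂ) ^ 2 = ((1 - ‖z‖ ^ 2 : ℝ) : ℂ) := by push_cast; ring
    rw [this, Complex.norm_real, Real.norm_of_nonneg (one_sub_sq_pos hz).le]
    exact one_sub_sq_le' hz hζ
  have h5 : ‖z - ζ‖ * ‖w - z‖ ≤ ‖1 - herm z w‖ + ‖1 - herm z ζ‖ := by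
    nlinarith [sq_nonneg (‖z - ζ‖ - ‖w - z‖)]
  rw [e]
  calc _ ≤ ‖1 - herm w z‖ + ‖inner ℂ (z - ζ) (w - z)‖ + (‖1 - herm z ζ‖ + ‖(1 : ℂ) - (‖z‖:ℂ) ^ 2‖) := by
        refine (norm_add_le _ _).trans (add_le_add (norm_add_le _ _) (norm_sub_le _ _))
    _ ≤ _ := by rw [norm_herm_comm w z]; linarith

theorem continuous_herm : Continuous fun p : En n × En n => herm p.1 p.2 := by
  simp only [herm_eq_inner]; fun_prop

@[fun_prop]
theorem measurable_herm {α : Type*} [MeasurableSpace α] {f g : α → En n} (hf : Measurable f)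
    (hg : Measurable g) : Measurable fun x => herm (f x) (g x) :=
  continuous_herm.measurable.comp (hf.prodMk hg)

@[fun_prop]
theorem measurable_trid {α : Type*} [MeasurableSpace α] {f g : α → En n} (hf : Measurable f)
    (hg : Measurable g) : Measurable fun x => trid (f x) (g x) := by
  unfold trid
  fun_prop

end pointwise

theorem inner_one_dim {t : ℝ} (ht : -1 < t) (ht0 : t < 0) : ∃ K : ℝ, 0 < K ∧
    ∀ β ρ : ℝ, β ≤ 1 → 0 < ρ →
    ∫⁻ l in Ioo (1 - ρ) 1 ∩ Iio β, ENNReal.ofReal ((β - l) ^ t) ≤ ENNReal.ofReal (K * ρ ^ (1 + t)) := by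
  have h1 : (2:ℝ) ^ (-(1 + t)) < 1 :=
    Real.rpow_lt_one_of_one_lt_of_neg (by norm_num) (by linarith)
  refine ⟨(2:ℝ) ^ (1 - t) / (1 - (2:ℝ) ^ (-(1 + t))), div_pos (by positivity) (by linarith), ?_⟩
  intro β ρ hβ hρ
  have hm : MeasurableSet (Ioo (1 - ρ) 1 ∩ Iio β) := measurableSet_Ioo.inter measurableSet_Iio
  have := dyadic_down (volume.restrict (Ioo (1 - ρ) 1 ∩ Iio β)) (fun l => β - l) (by fun_prop)
    (R := ρ) (m := 1) (c := t) hρ (by linarith) ht0 1 ?_ ?_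
  · rwa [one_mul] at this
  · filter_upwards [ae_restrict_mem hm] with l hl
    simp only [mem_inter_iff, mem_Ioo, mem_Iio] at hl
    constructor <;> linarith
  · intro r hr
    rw [Measure.restrict_apply (measurableSet_lt (by fun_prop) (by fun_prop)), one_mul, Real.rpow_one]
    calc _ ≤ volume (Ioo (β - r) β) := by
          apply measure_mono
          rintro l ⟨h1, h2, h3⟩
          change β - l < r at h1
          exact ⟨by linarith, h3⟩
      _ = _ := by rw [Real.volume_Ioo]; congr 1; ring

theorem tent_meas (n : ℕ) (hn : 1 ≤ n) (t : ℝ) (ht : -1 < t) : ∃ C : ℝ, 0 < C ∧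
    ∀ w : En n, ‖w‖ < 1 → ∀ r, 1 - ‖w‖ ≤ r →
      ∫⁻ z in ball (0 : En n) 1 ∩ {z | ‖1 - herm z w‖ < r}, ENNReal.ofReal ((1 - ‖z‖ ^ 2) ^ t) ≤
        ENNReal.ofReal (C * r ^ ((n : ℝ) + 1 + t)) := by
  obtain ⟨C, hC, hbox⟩ := box_vol n hn
  obtain ⟨K, hK, hin⟩ : ∃ K : ℝ, 0 < K ∧ ∀ r, 0 < r → r ≤ 2 → ∀ w z : En n, ‖w‖ < 1 → 
      ∫⁻ l in Ioo (1 - r / 4) 1, (ball (0 : En n) 1 ∩ {z | ‖1 - herm z w‖ < r}).indicator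
        (fun z => ENNReal.ofReal ((1 - ‖z‖ ^ 2) ^ t)) (l • z) ≤ ENNReal.ofReal (K * r ^ (1 + t)) := by
    rcases lt_or_ge t 0 with ht0 | ht0
    · obtain ⟨K, hK, hin⟩ := inner_one_dim ht ht0
      refine ⟨K * (1/4) ^ (1 + t), by positivity, ?_⟩
      intro r hr hr2 w z hw
      let β : ℝ := if ‖z‖ ≤ 1 then 1 else ‖z‖⁻¹
      have hβ : β ≤ 1 := by
        simp only [β]; split_ifs with h
        · exact le_rfl
        · exact inv_le_one_of_one_le₀ (by linarith)
      have h := hin β (r/4) hβ (by positivity)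
      rw [mul_assoc, ← Real.mul_rpow (by norm_num) hr.le, show (1/4) * r = r / 4 by ring]
      refine le_trans ?_ h
      rw [← lintegral_indicator (measurableSet_Ioo.inter measurableSet_Iio),
        ← lintegral_indicator measurableSet_Ioo]
      apply lintegral_mono
      intro l
      by_cases hl : l ∈ Ioo (1 - r / 4) 1
      · rw [indicator_of_mem hl]
        by_cases hm : l • z ∈ ball (0 : En n) 1 ∩ {z | ‖1 - herm z w‖ < r}
        · rw [indicator_of_mem hm]
          have hl0 : 0 < l := by have := hl.1; linarith
          have hlz : l * ‖z‖ < 1 := by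
            have := hm.1
            rwa [mem_ball_zero_iff, norm_smul, Real.norm_of_nonneg hl0.le] at this
          have hz0 := norm_nonneg z
          have hl1 := hl.2
          have key : 0 < β - l ∧ β - l ≤ 1 - l * ‖z‖ := by
            simp only [β]; split_ifs with hz
            · constructor
              · linarith
              · nlinarith
            · push Not at hz
              have hi : ‖z‖ * ‖z‖⁻¹ = 1 := mul_inv_cancel₀ (by linarith)
              have hd : 0 < ‖z‖⁻¹ - l := by
                rw [sub_pos, lt_inv_comm₀ hl0 (by linarith), ← one_div, lt_div_iff₀ hl0]; linarith
              refine ⟨hd, ?_⟩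
              have : 1 - l * ‖z‖ = ‖z‖ * (‖z‖⁻¹ - l) := by rw [mul_sub, hi]; ring
              rw [this]; nlinarith
          have hl' : l ∈ Ioo (1 - r / 4) 1 ∩ Iio β := ⟨hl, by simp only [mem_Iio]; linarith [key.1]⟩
          rw [indicator_of_mem hl']
          apply ENNReal.ofReal_le_ofReal
          apply Real.rpow_le_rpow_of_nonpos key.1 _ ht0.le
          rw [norm_smul, Real.norm_of_nonneg hl0.le]
          have : 0 ≤ l * ‖z‖ := by positivity
          nlinarith [key.2]
        · rw [indicator_of_notMem hm]; exact zero_le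
      · rw [indicator_of_notMem hl]; exact zero_le
    · refine ⟨2 ^ t, by positivity, ?_⟩
      intro r hr hr2 w z hw
      calc _ ≤ ∫⁻ l in Ioo (1 - r / 4) 1, ENNReal.ofReal ((2 * r) ^ t) := by
            apply lintegral_mono
            intro l
            dsimp only
            refine indicator_apply_le (g := fun _ => ENNReal.ofReal ((2 * r) ^ t)) ?_
            intro hm
            apply ENNReal.ofReal_le_ofReal
            have hm1 : ‖l • z‖ < 1 := by simpa using hm.1
            have hm2 : ‖1 - herm (l • z) w‖ < r := hm.2
            apply Real.rpow_le_rpow (one_sub_sq_pos hm1).le _ ht0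
            have := one_sub_sq_le' hm1 hw
            linarith
        _ = ENNReal.ofReal ((2 * r) ^ t * (r / 4)) := by
            rw [setLIntegral_const, Real.volume_Ioo, ← ENNReal.ofReal_mul (by positivity)]
            congr 2; ring
        _ ≤ _ := by
            apply ENNReal.ofReal_le_ofReal
            rw [Real.mul_rpow (by norm_num) hr.le, Real.rpow_add hr, Real.rpow_one]
            have : 0 ≤ (2:ℝ) ^ t * (r * r ^ t) := by positivity
            linarith
  have main : ∀ w : En n, ‖w‖ < 1 → ∀ r, 1 - ‖w‖ ≤ r → r ≤ 2 →
      ∫⁻ z in ball (0 : En n) 1 ∩ {z | ‖1 - herm z w‖ < r}, ENNReal.ofReal ((1 - ‖z‖ ^ 2) ^ t) ≤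
        ENNReal.ofReal (4 * K * C * 9 ^ n * r ^ ((n : ℝ) + 1 + t)) := by
    intro w hw r hr hr2
    have hr0 : 0 < r := by linarith
    obtain ⟨u, hu1, hu⟩ := exists_unit hn w
    set E : Set (En n) := ball (0 : En n) 1 ∩ {z | ‖1 - herm z w‖ < r} with hE
    have hEm : MeasurableSet E := measurableSet_ball.inter
      (measurableSet_lt (by fun_prop) (by fun_prop))
    set G : En n → ℝ≥0∞ := E.indicator (fun z => ENNReal.ofReal ((1 - ‖z‖ ^ 2) ^ t)) with hG
    have hGm : Measurable G := Measurable.indicator (by fun_prop) hEm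
    set B : Set (En n) := {z | ‖1 - herm z u‖ < 3 * r ∧ ‖z‖ ^ 2 - ‖herm z u‖ ^ 2 < 9 * r} with hB
    have hBm : MeasurableSet B := by
      have h1 : MeasurableSet {z : En n | ‖1 - herm z u‖ < 3 * r} :=
        measurableSet_lt (by fun_prop) (by fun_prop)
      have h2 : MeasurableSet {z : En n | ‖z‖ ^ 2 - ‖herm z u‖ ^ 2 < 9 * r} :=
        measurableSet_lt (by fun_prop) (by fun_prop)
      exact h1.inter h2
    rw [← lintegral_indicator hEm]
    change ∫⁻ z, G z ≤ _
    have hmem : ∀ l ∈ Ioo (1 - r / 4) 1, ∀ z, l • z ∈ E → z ∈ B := by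
      rintro l ⟨hl1, hl2⟩ z ⟨hz1, hz2⟩
      change ‖1 - herm (l • z) w‖ < r at hz2
      have hl0 : 0 < l := by linarith
      rw [mem_ball_zero_iff, norm_smul, Real.norm_of_nonneg hl0.le] at hz1
      have hh : herm (l • z) u = (l : ℂ) * herm z u := by
        simp only [herm, Finset.mul_sum, PiLp.smul_apply, Complex.real_smul, mul_assoc]
      have hzu : ‖herm z u‖ ≤ ‖z‖ := by have := norm_herm_le z u; rwa [hu1, mul_one] at this
      have hz0 := norm_nonneg z
      have hz2' : ‖z‖ < 2 := by nlinarith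
      have hx0 := norm_nonneg (herm z u)
      have e1 : ‖1 - herm z u‖ < 3 * r := by
        rw [hu, hh] at hz2
        have e : 1 - herm z u = (1 - (‖w‖:ℂ) * (l * herm z u)) +
          (-(((1 - ‖w‖ : ℝ) : ℂ) * (l * herm z u)) + -(((1 - l : ℝ) : ℂ) * herm z u)) := by
          push_cast; ring
        have n1 : ‖-(((1 - ‖w‖ : ℝ) : ℂ) * (l * herm z u))‖ ≤ r := by
          rw [norm_neg, norm_mul, norm_mul, Complex.norm_real, Complex.norm_real,
            Real.norm_of_nonneg (by linarith), Real.norm_of_nonneg hl0.le]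
          have : l * ‖herm z u‖ ≤ 1 := by nlinarith
          nlinarith
        have n2 : ‖-(((1 - l : ℝ) : ℂ) * herm z u)‖ ≤ r / 2 := by
          rw [norm_neg, norm_mul, Complex.norm_real, Real.norm_of_nonneg (by linarith)]
          nlinarith
        rw [e]
        refine (norm_add_le _ _).trans_lt ?_
        have := norm_add_le (-(((1 - ‖w‖ : ℝ) : ℂ) * (l * herm z u))) (-(((1 - l : ℝ) : ℂ) * herm z u))
        linarith
      refine ⟨e1, ?_⟩
      have h3 : 1 - 3 * r ≤ ‖herm z u‖ := by
        have := norm_sub_norm_le (1:ℂ) (herm z u)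
        simp at this; linarith
      have h4 : ‖z‖ ≤ 1 + r / 2 := by nlinarith
      have h5 : ‖z‖ ^ 2 ≤ 1 + 2 * r := by nlinarith
      have h6 : 1 - 6 * r ≤ ‖herm z u‖ ^ 2 := by nlinarith [sq_nonneg (‖herm z u‖ - 1)]
      linarith
    have hinner : ∀ z, ∫⁻ l in Ioo (1 - r / 4) 1, G (l • z) ≤
        B.indicator (fun _ => ENNReal.ofReal (K * r ^ (1 + t))) z := by
      intro z
      by_cases hz : z ∈ B
      · rw [indicator_of_mem hz]; exact hin r hr0 hr2 w z hw
      · rw [indicator_of_notMem hz, nonpos_iff_eq_zero]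
        rw [setLIntegral_eq_zero measurableSet_Ioo]
        intro l hl
        exact indicator_of_notMem (fun h => hz (hmem l hl z h)) _
    have hscale : ∀ l ∈ Ioo (1 - r / 4) 1, ∫⁻ z, G z ≤ ∫⁻ z, G (l • z) := by
      rintro l ⟨hl1, hl2⟩
      have hl0 : 0 < l := by linarith
      have := Measure.map_addHaar_smul (volume : Measure (En n)) hl0.ne'
      rw [← lintegral_map (g := fun z : En n => l • z) hGm (by fun_prop), this, lintegral_smul_measure, smul_eq_mul]
      refine le_mul_of_one_le_left' ?_
      rw [ENNReal.one_le_ofReal, abs_of_pos (by positivity)]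
      exact (one_le_inv₀ (by positivity)).2 (pow_le_one₀ hl0.le hl2.le)
    have hJ : ENNReal.ofReal (r / 4) * ∫⁻ z, G z ≤
        ENNReal.ofReal (K * r ^ (1 + t)) * ENNReal.ofReal (C * ((3 * r) ^ 2 * (9 * r) ^ (n - 1))) :=
      calc _ = ∫⁻ l in Ioo (1 - r / 4) 1, ∫⁻ z, G z := by
            rw [setLIntegral_const, Real.volume_Ioo, mul_comm]; congr 2; ring
        _ ≤ ∫⁻ l in Ioo (1 - r / 4) 1, ∫⁻ z, G (l • z) :=
            setLIntegral_mono' measurableSet_Ioo hscale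
        _ = ∫⁻ z, ∫⁻ l in Ioo (1 - r / 4) 1, G (l • z) := by
            apply lintegral_lintegral_swap
            apply Measurable.aemeasurable
            exact hGm.comp (by fun_prop)
        _ ≤ ∫⁻ z, B.indicator (fun _ => ENNReal.ofReal (K * r ^ (1 + t))) z := lintegral_mono hinner
        _ = ENNReal.ofReal (K * r ^ (1 + t)) * volume B := lintegral_indicator_const hBm _
        _ ≤ _ := by gcongr; exact hbox u hu1 1 _ _ (by positivity) (by positivity)
    rw [← ENNReal.ofReal_mul (by positivity)] at hJ
    have hr4 : ENNReal.ofReal (r / 4) ≠ 0 := by simpa using hr0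
    rw [mul_comm, ← ENNReal.le_div_iff_mul_le (Or.inl hr4) (Or.inl ENNReal.ofReal_ne_top),
      ← ENNReal.ofReal_div_of_pos (by positivity)] at hJ
    refine hJ.trans (ENNReal.ofReal_le_ofReal (le_of_eq ?_))
    obtain ⟨m, rfl⟩ : ∃ m, n = m + 1 := ⟨n - 1, by omega⟩
    simp only [Nat.add_sub_cancel]
    rw [add_assoc ((m+1 : ℕ) : ℝ) 1 t, Real.rpow_add hr0 ((m+1 : ℕ) : ℝ), Real.rpow_natCast,
      Real.rpow_add hr0, Real.rpow_one]
    field_simp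
    ring
  refine ⟨4 * K * C * 9 ^ n, by positivity, ?_⟩
  intro w hw r hr
  rcases le_or_gt r 2 with h2 | h2
  · exact main w hw r hr h2
  · have h := main w hw 2 (by have := norm_nonneg w; linarith) le_rfl
    calc _ ≤ _ := by
          refine lintegral_mono_set (t := ball (0 : En n) 1 ∩ {z | ‖1 - herm z w‖ < 2}) ?_
          rintro z ⟨hz, _⟩
          refine ⟨hz, ?_⟩
          rw [mem_ball_zero_iff] at hz
          have h1 := norm_herm_le z w
          have h2 : ‖1 - herm z w‖ ≤ ‖(1:ℂ)‖ + ‖herm z w‖ := norm_sub_le _ _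
          have h3 : ‖z‖ * ‖w‖ < 1 := by nlinarith [norm_nonneg z, norm_nonneg w]
          change ‖1 - herm z w‖ < 2
          simp at h2; linarith
      _ ≤ _ := h
      _ ≤ _ := by
          apply ENNReal.ofReal_le_ofReal
          gcongr
          linarith

theorem FR_basic (n : ℕ) (hn : 1 ≤ n) (t s : ℝ) (ht : -1 < t) (hs : 0 < s) : ∃ C : ℝ, 0 < C ∧
    ∀ w : En n, ‖w‖ < 1 →
      ∫⁻ z in ball (0 : En n) 1,
        ENNReal.ofReal ((1 - ‖z‖ ^ 2) ^ t * ‖1 - herm z w‖ ^ (-((n:ℝ) + 1 + t + s))) ≤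
        ENNReal.ofReal (C * (1 - ‖w‖ ^ 2) ^ (-s)) := by
  obtain ⟨C0, hC0, hT⟩ := tent_meas n hn t ht
  have h1 : (2:ℝ) ^ ((n:ℝ) + 1 + t - ((n:ℝ) + 1 + t + s)) < 1 :=
    Real.rpow_lt_one_of_one_lt_of_neg (by norm_num) (by linarith)
  set K := (2:ℝ) ^ ((n:ℝ) + 1 + t) / (1 - (2:ℝ) ^ ((n:ℝ) + 1 + t - ((n:ℝ) + 1 + t + s))) with hK
  have hKpos : 0 < K := div_pos (by positivity) (by linarith)
  refine ⟨C0 * K * 2 ^ s, by positivity, ?_⟩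
  intro w hw
  have hdm : Measurable fun z : En n => ENNReal.ofReal ((1 - ‖z‖ ^ 2) ^ t) := by fun_prop
  have hXm : Measurable fun z : En n => ‖1 - herm z w‖ := by fun_prop
  have := dyadic_up (((volume : Measure (En n)).restrict (ball 0 1)).withDensity
    (fun z => ENNReal.ofReal ((1 - ‖z‖ ^ 2) ^ t))) (fun z => ‖1 - herm z w‖) hXm
    (δ := 1 - ‖w‖) (m := (n:ℝ) + 1 + t) (q := (n:ℝ) + 1 + t + s) (by linarith) (by linarith)
    (by have : (0:ℝ) ≤ n := by positivity
        linarith) (ENNReal.ofReal C0) ?_ ?_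
  · rw [lintegral_withDensity_eq_lintegral_mul _ hdm (by fun_prop)] at this
    calc _ ≤ _ := by
          refine setLIntegral_mono' measurableSet_ball (fun z hz => le_of_eq ?_)
          rw [mem_ball_zero_iff] at hz
          exact ENNReal.ofReal_mul (by have := one_sub_sq_pos hz; positivity)
      _ ≤ _ := this
      _ ≤ _ := by
          rw [← ENNReal.ofReal_mul hC0.le]
          apply ENNReal.ofReal_le_ofReal
          rw [← hK, mul_assoc C0, mul_assoc C0, mul_assoc K]
          gcongr
          rw [show (n:ℝ) + 1 + t - ((n:ℝ) + 1 + t + s) = -s by ring]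
          have hD := one_sub_sq_pos hw
          have : (1 - ‖w‖) ^ (-s) ≤ ((1 - ‖w‖ ^ 2) / 2) ^ (-s) := by
            apply Real.rpow_le_rpow_of_nonpos (by positivity) _ (by linarith)
            nlinarith [norm_nonneg w]
          refine this.trans (le_of_eq ?_)
          rw [Real.div_rpow hD.le (by norm_num), Real.rpow_neg (by norm_num : (0:ℝ) ≤ 2)]
          field_simp
  · refine (withDensity_absolutelyContinuous _ _).ae_le ?_
    filter_upwards [ae_restrict_mem measurableSet_ball] with z hz
    rw [mem_ball_zero_iff] at hz
    exact one_sub_norm_le hz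
  · intro r hr
    have hm : MeasurableSet {z : En n | ‖1 - herm z w‖ < r} := measurableSet_lt hXm measurable_const
    rw [withDensity_apply _ hm, Measure.restrict_restrict hm, inter_comm, ← ENNReal.ofReal_mul hC0.le]
    exact hT w hw r hr

theorem rpow_comparable {D x k p : ℝ} (hD : 0 < D) (hk : 1 ≤ k) (h1 : D / k ≤ x) (h2 : x ≤ k * D) :
    x ^ p ≤ k ^ |p| * D ^ p := by
  have hk0 : 0 < k := by linarith
  have hx : 0 < x := lt_of_lt_of_le (by positivity) h1
  rcases le_total 0 p with hp | hp
  · rw [abs_of_nonneg hp, ← Real.mul_rpow hk0.le hD.le]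
    exact Real.rpow_le_rpow hx.le h2 hp
  · rw [abs_of_nonpos hp, Real.rpow_neg hk0.le, ← div_eq_inv_mul, ← Real.div_rpow hD.le hk0.le]
    exact Real.rpow_le_rpow_of_nonpos (by positivity) h1 hp

theorem FR_sing (n : ℕ) (hn : 1 ≤ n) (c : ℝ) (hc : -2 * (n:ℝ) < c) (hc0 : c < 0) :
    ∃ C : ℝ, 0 < C ∧ ∀ w : En n, ‖w‖ < 1 → ∀ S : Set (En n), MeasurableSet S →
      (∀ z ∈ S, √(trid z w) ≤ 2 * (1 - ‖w‖ ^ 2)) →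
      ∫⁻ z in S, ENNReal.ofReal (√(trid z w) ^ c) ≤
        ENNReal.ofReal (C * (1 - ‖w‖ ^ 2) ^ ((n:ℝ) + 1 + c)) := by
  obtain ⟨C0, hC0, hbox⟩ := box_vol n hn
  have h1 : (2:ℝ) ^ (-(2 * (n:ℝ) + c)) < 1 :=
    Real.rpow_lt_one_of_one_lt_of_neg (by norm_num) (by linarith)
  set K := (2:ℝ) ^ (2 * (n:ℝ) - c) / (1 - (2:ℝ) ^ (-(2 * (n:ℝ) + c))) with hK
  have hKpos : 0 < K := div_pos (by positivity) (by linarith)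
  refine ⟨C0 * K * 2 ^ (2 * (n:ℝ) + c), by positivity, ?_⟩
  intro w hw S hS hSle
  have hD := one_sub_sq_pos hw
  obtain ⟨u, hu1, hu⟩ := exists_unit hn w
  set D := 1 - ‖w‖ ^ 2 with hDdef
  have := dyadic_down ((volume : Measure (En n)).restrict S) (fun z => √(trid z w)) (by fun_prop)
    (R := 2 * D) (m := 2 * (n:ℝ)) (c := c) (by positivity) (by linarith) hc0
    (ENNReal.ofReal (C0 * D ^ (-((n:ℝ) - 1)))) ?_ ?_
  · refine this.trans ?_
    rw [← ENNReal.ofReal_mul (by positivity), ← hK]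
    apply ENNReal.ofReal_le_ofReal
    rw [Real.mul_rpow (by norm_num) hD.le]
    have : D ^ ((n:ℝ) + 1 + c) = D ^ (-((n:ℝ) - 1)) * D ^ (2 * (n:ℝ) + c) := by
      rw [← Real.rpow_add hD]; congr 1; ring
    rw [this]; apply le_of_eq; ring
  · filter_upwards [ae_restrict_mem hS] with z hz
    exact ⟨Real.sqrt_nonneg _, hSle z hz⟩
  · intro r hr
    refine (Measure.restrict_apply_le _ _).trans ?_
    have hsub : {z : En n | √(trid z w) < r} ⊆
        {z : En n | ‖(‖w‖:ℂ) - herm z u‖ < r ∧ ‖z‖ ^ 2 - ‖herm z u‖ ^ 2 < r ^ 2 / D} := by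
      intro z hz
      change √(trid z w) < r at hz
      rw [Real.sqrt_lt' hr, trid_formula hu] at hz
      have h := norm_herm_le z u
      rw [hu1, mul_one] at h
      have h2 : ‖herm z u‖ ^ 2 ≤ ‖z‖ ^ 2 := by gcongr
      have h3 : 0 ≤ D * (‖z‖ ^ 2 - ‖herm z u‖ ^ 2) := mul_nonneg hD.le (by linarith)
      constructor
      · apply lt_of_pow_lt_pow_left₀ 2 hr.le; linarith
      · rw [lt_div_iff₀ hD]; nlinarith [sq_nonneg ‖(‖w‖:ℂ) - herm z u‖]
    refine (measure_mono hsub).trans ((hbox u hu1 _ _ _ hr (by positivity)).trans (le_of_eq ?_))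
    rw [← ENNReal.ofReal_mul (by positivity)]
    congr 1
    obtain ⟨m, rfl⟩ : ∃ m, n = m + 1 := ⟨n - 1, by omega⟩
    have e1 : r ^ (2 * ((m + 1 : ℕ):ℝ)) = r ^ (2 * (m + 1)) := by
      rw [← Real.rpow_natCast]; push_cast; rfl
    have e2 : D ^ (-(((m + 1 : ℕ):ℝ) - 1)) = (D ^ m)⁻¹ := by
      rw [Real.rpow_neg hD.le]; push_cast; rw [add_sub_cancel_right, Real.rpow_natCast]
    rw [e1, e2]
    simp only [Nat.add_sub_cancel]
    rw [div_pow]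
    field_simp
    ring

theorem FR (n : ℕ) (hn : 1 ≤ n) (t s c : ℝ) (ht : -1 < t) (hs : 0 < s) (hc : -2 * (n:ℝ) < c) :
    ∃ C : ℝ, 0 < C ∧ ∀ w : En n, ‖w‖ < 1 →
      ∫⁻ z in ball (0 : En n) 1,
        ENNReal.ofReal ((1 - ‖z‖ ^ 2) ^ t * √(trid z w) ^ c *
          ‖1 - herm z w‖ ^ (-((n:ℝ) + 1 + t + s + c))) ≤
        ENNReal.ofReal (C * (1 - ‖w‖ ^ 2) ^ (-s)) := by
  obtain ⟨C1, hC1, hF⟩ := FR_basic n hn t s ht hs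
  rcases le_or_gt 0 c with hc0 | hc0
  · refine ⟨C1, hC1, fun w hw => le_trans ?_ (hF w hw)⟩
    refine setLIntegral_mono' measurableSet_ball (fun z hz => ENNReal.ofReal_le_ofReal ?_)
    rw [mem_ball_zero_iff] at hz
    have hX := X_pos hz hw
    have hz' := one_sub_sq_pos hz
    have : √(trid z w) ≤ ‖1 - herm z w‖ := by
      rw [Real.sqrt_le_left hX.le]; exact trid_le hz hw
    calc _ ≤ (1 - ‖z‖ ^ 2) ^ t * ‖1 - herm z w‖ ^ c *
          ‖1 - herm z w‖ ^ (-((n:ℝ) + 1 + t + s + c)) := by gcongr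
      _ = _ := by
          rw [mul_assoc, ← Real.rpow_add hX]; congr 2; ring
  · obtain ⟨C2, hC2, hG⟩ := FR_sing n hn c hc hc0
    set N := (n:ℝ) + 1 + t + s with hN
    refine ⟨2 ^ (-c) * C1 + 6 ^ |t| * 6 ^ |-(N + c)| * C2, by positivity, ?_⟩
    intro w hw
    have hD := one_sub_sq_pos hw
    set F : En n → ℝ≥0∞ := fun z => ENNReal.ofReal ((1 - ‖z‖ ^ 2) ^ t * √(trid z w) ^ c *
          ‖1 - herm z w‖ ^ (-(N + c))) with hFdef
    set S : Set (En n) := {z | √(trid z w) < ‖1 - herm z w‖ / 2} with hSdef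
    have hSm : MeasurableSet S := measurableSet_lt (by fun_prop) (by fun_prop)
    change ∫⁻ z in ball (0 : En n) 1, F z ≤ _
    rw [← lintegral_inter_add_sdiff F (ball (0 : En n) 1) hSm]
    have hA : ∫⁻ z in ball (0 : En n) 1 \ S, F z ≤
        ENNReal.ofReal (2 ^ (-c) * C1 * (1 - ‖w‖ ^ 2) ^ (-s)) := by
      calc _ ≤ ∫⁻ z in ball (0 : En n) 1 \ S, ENNReal.ofReal (2 ^ (-c)) *
            ENNReal.ofReal ((1 - ‖z‖ ^ 2) ^ t * ‖1 - herm z w‖ ^ (-N)) := by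
            refine setLIntegral_mono' (measurableSet_ball.diff hSm) (fun z hz => ?_)
            rw [← ENNReal.ofReal_mul (by positivity)]
            apply ENNReal.ofReal_le_ofReal
            have hz1 := hz.1
            rw [mem_ball_zero_iff] at hz1
            have hX := X_pos hz1 hw
            have hz' := one_sub_sq_pos hz1
            have hge : ‖1 - herm z w‖ / 2 ≤ √(trid z w) := not_lt.1 hz.2
            have h3 : √(trid z w) ^ c ≤ (‖1 - herm z w‖ / 2) ^ c :=
              Real.rpow_le_rpow_of_nonpos (by positivity) hge hc0.le
            calc _ ≤ (1 - ‖z‖ ^ 2) ^ t * (‖1 - herm z w‖ / 2) ^ c *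
                  ‖1 - herm z w‖ ^ (-(N + c)) := by gcongr
              _ = 2 ^ (-c) * ((1 - ‖z‖ ^ 2) ^ t * (‖1 - herm z w‖ ^ c * ‖1 - herm z w‖ ^ (-(N + c)))) := by
                  rw [Real.div_rpow hX.le (by norm_num), Real.rpow_neg (by norm_num : (0:ℝ) ≤ 2)]
                  ring
              _ = _ := by
                  rw [← Real.rpow_add hX]; congr 3; ring
        _ ≤ ∫⁻ z in ball (0 : En n) 1, ENNReal.ofReal (2 ^ (-c)) *
            ENNReal.ofReal ((1 - ‖z‖ ^ 2) ^ t * ‖1 - herm z w‖ ^ (-N)) :=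
            lintegral_mono_set sdiff_subset
        _ = ENNReal.ofReal (2 ^ (-c)) * ∫⁻ z in ball (0 : En n) 1, 
            ENNReal.ofReal ((1 - ‖z‖ ^ 2) ^ t * ‖1 - herm z w‖ ^ (-N)) :=
            lintegral_const_mul' _ _ ENNReal.ofReal_ne_top
        _ ≤ ENNReal.ofReal (2 ^ (-c)) * ENNReal.ofReal (C1 * (1 - ‖w‖ ^ 2) ^ (-s)) := by
            gcongr; exact hF w hw
        _ = _ := by rw [← ENNReal.ofReal_mul (by positivity), mul_assoc]
    have hcomp : ∀ z ∈ ball (0 : En n) 1 ∩ S, √(trid z w) ≤ 2 * (1 - ‖w‖ ^ 2) ∧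
        (1 - ‖z‖ ^ 2) ^ t ≤ 6 ^ |t| * (1 - ‖w‖ ^ 2) ^ t ∧
        ‖1 - herm z w‖ ^ (-(N + c)) ≤ 6 ^ |-(N + c)| * (1 - ‖w‖ ^ 2) ^ (-(N + c)) := by
      rintro z ⟨hz, hzS⟩
      rw [mem_ball_zero_iff] at hz
      change √(trid z w) < ‖1 - herm z w‖ / 2 at hzS
      have hX := X_pos hz hw
      have hlt := hzS
      rw [Real.sqrt_lt' (by positivity)] at hlt
      unfold trid at hlt
      have hz' := one_sub_sq_pos hz
      have a1 := one_sub_sq_le hz hw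
      have a2 := one_sub_sq_le' hz hw
      set X := ‖1 - herm z w‖
      set D := 1 - ‖w‖ ^ 2
      set d := 1 - ‖z‖ ^ 2
      have b1 : 3 / 4 * X ^ 2 < d * D := by nlinarith
      have b2 : X ≤ 8 / 3 * D := by
        by_contra hcon
        push Not at hcon
        nlinarith
      have b3 : 3 / 16 * D ≤ d := by
        by_contra hcon
        push Not at hcon
        nlinarith
      refine ⟨by linarith, rpow_comparable hD (by norm_num) (by linarith) (by linarith),
        rpow_comparable hD (by norm_num) (by linarith) (by linarith)⟩
    have hB : ∫⁻ z in ball (0 : En n) 1 ∩ S, F z ≤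
        ENNReal.ofReal (6 ^ |t| * 6 ^ |-(N + c)| * C2 * (1 - ‖w‖ ^ 2) ^ (-s)) := by
      have hm : MeasurableSet (ball (0 : En n) 1 ∩ S) := measurableSet_ball.inter hSm
      set D := 1 - ‖w‖ ^ 2 with hDdef
      calc _ ≤ ∫⁻ z in ball (0 : En n) 1 ∩ S,
            ENNReal.ofReal (6 ^ |t| * D ^ t * (6 ^ |-(N + c)| * D ^ (-(N + c)))) *
              ENNReal.ofReal (√(trid z w) ^ c) := by
            refine setLIntegral_mono' hm (fun z hz => ?_)
            rw [← ENNReal.ofReal_mul (by positivity)]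
            apply ENNReal.ofReal_le_ofReal
            obtain ⟨_, h2, h3⟩ := hcomp z hz
            have hz1 := hz.1
            rw [mem_ball_zero_iff] at hz1
            have hz' := one_sub_sq_pos hz1
            calc _ ≤ (6 ^ |t| * D ^ t) * √(trid z w) ^ c * (6 ^ |-(N + c)| * D ^ (-(N + c))) := by
                  gcongr
              _ = _ := by ring
        _ = ENNReal.ofReal (6 ^ |t| * D ^ t * (6 ^ |-(N + c)| * D ^ (-(N + c)))) *
              ∫⁻ z in ball (0 : En n) 1 ∩ S, ENNReal.ofReal (√(trid z w) ^ c) :=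
            lintegral_const_mul' _ _ ENNReal.ofReal_ne_top
        _ ≤ ENNReal.ofReal (6 ^ |t| * D ^ t * (6 ^ |-(N + c)| * D ^ (-(N + c)))) *
              ENNReal.ofReal (C2 * D ^ ((n:ℝ) + 1 + c)) := by
            gcongr
            exact hG w hw _ hm fun z hz => (hcomp z hz).1
        _ = _ := by
            rw [← ENNReal.ofReal_mul (by positivity)]
            congr 1
            have : D ^ (-s) = D ^ t * D ^ (-(N + c)) * D ^ ((n:ℝ) + 1 + c) := by
              rw [← Real.rpow_add hD, ← Real.rpow_add hD]; congr 1; rw [hN]; ring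
            rw [this]; ring
    calc _ ≤ _ := add_le_add hB hA
      _ = _ := by
        rw [← ENNReal.ofReal_add (by positivity) (by positivity)]
        congr 1; ring

theorem mem_tent {n : ℕ} {z ζ : En n} (hζ : ‖ζ‖ < 1) :
    z ∈ tent ζ ↔ ‖z‖ < 1 ∧ ‖1 - herm z ζ‖ < 2 * (1 - ‖ζ‖) := by
  unfold tent
  constructor
  · rintro ⟨h1, h2⟩
    rw [mem_ball_zero_iff] at h1
    rw [lt_div_iff₀ (X_pos h1 hζ)] at h2
    exact ⟨h1, by linarith⟩
  · rintro ⟨h1, h2⟩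
    refine ⟨by simpa using h1, ?_⟩
    rw [lt_div_iff₀ (X_pos h1 hζ)]
    linarith

theorem tent_eq {n : ℕ} {ζ : En n} (hζ : ‖ζ‖ < 1) :
    tent ζ = ball (0 : En n) 1 ∩ {z | ‖1 - herm z ζ‖ < 2 * (1 - ‖ζ‖)} := by
  ext z
  rw [mem_tent hζ, mem_inter_iff, mem_ball_zero_iff]; rfl

theorem measurableSet_tent {n : ℕ} {ζ : En n} (hζ : ‖ζ‖ < 1) : MeasurableSet (tent ζ) := by
  rw [tent_eq hζ]
  exact measurableSet_ball.inter (measurableSet_lt (by fun_prop) (by fun_prop))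

theorem J_bound (n : ℕ) (hn : 1 ≤ n) (t s c : ℝ) (ht : -1 < t) (hs : 0 < s) (hc : -2 * (n:ℝ) < c) :
    ∃ C : ℝ, 0 < C ∧ ∀ w ζ : En n, ‖w‖ < 1 → ‖ζ‖ < 1 →
      ∫⁻ z in tent ζ,
        ENNReal.ofReal ((1 - ‖z‖ ^ 2) ^ t * √(trid z w) ^ c *
          ‖1 - herm z w‖ ^ (-((n:ℝ) + 1 + t + s + c))) ≤
        ENNReal.ofReal (C * (1 - ‖w‖ ^ 2) ^ (-s) *
          ((1 - ‖ζ‖) / ‖1 - herm w ζ‖) ^ ((n:ℝ) + 1 + t)) := by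
  obtain ⟨C1, hC1, hF⟩ := FR n hn t s c ht hs hc
  obtain ⟨C2, hC2, hT⟩ := tent_meas n hn t ht
  have hn0 : (0:ℝ) ≤ n := by positivity
  set ρ := (n:ℝ) + 1 + t with hρ
  have hρ0 : 0 < ρ := by linarith
  refine ⟨C1 * 256 ^ ρ + 2 ^ |c| * 4 ^ (ρ + s) * C2 * 2 ^ ρ * 2 ^ s, by positivity, ?_⟩
  intro w ζ hw hζ
  have hD := one_sub_sq_pos hw
  have hR := X_pos hw hζ
  have hδ : 0 < 1 - ‖ζ‖ := by linarith
  have hDR : 1 - ‖w‖ ^ 2 ≤ 2 * ‖1 - herm w ζ‖ := one_sub_sq_le' hw hζ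
  have hFw := hF w hw
  have hTζ := hT ζ hζ (2 * (1 - ‖ζ‖)) (by linarith)
  rw [← tent_eq hζ] at hTζ
  set D := 1 - ‖w‖ ^ 2 with hDdef
  set R := ‖1 - herm w ζ‖ with hRdef
  set δ := 1 - ‖ζ‖ with hδdef
  rcases lt_or_ge R (256 * δ) with hnear | hfar
  · calc _ ≤ _ := lintegral_mono_set (t := ball (0 : En n) 1)
          (fun z hz => by rw [mem_ball_zero_iff]; exact ((mem_tent hζ).1 hz).1)
      _ ≤ _ := hFw
      _ ≤ _ := by
        apply ENNReal.ofReal_le_ofReal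
        have h1 : 1 ≤ 256 ^ ρ * (δ / R) ^ ρ := by
          rw [← Real.mul_rpow (by norm_num) (by positivity)]
          apply Real.one_le_rpow _ hρ0.le
          rw [← mul_div_assoc, one_le_div hR]; exact hnear.le
        calc _ ≤ C1 * D ^ (-s) * (256 ^ ρ * (δ / R) ^ ρ) := le_mul_of_one_le_right (by positivity) h1
          _ = C1 * 256 ^ ρ * D ^ (-s) * (δ / R) ^ ρ := by ring
          _ ≤ _ := by
            gcongr
            exact le_add_of_nonneg_right (by positivity)
  · have hpt : ∀ z ∈ tent ζ, (1 - ‖z‖ ^ 2) ^ t * √(trid z w) ^ c *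
          ‖1 - herm z w‖ ^ (-(ρ + s + c)) ≤
          2 ^ |c| * 4 ^ (ρ + s) * R ^ (-(ρ + s)) * (1 - ‖z‖ ^ 2) ^ t := by
      intro z hz
      obtain ⟨hz1, hz2⟩ := (mem_tent hζ).1 hz
      have hz' := one_sub_sq_pos hz1
      have hX := X_pos hz1 hw
      have q := quasi_triangle hw hz1 hζ
      rw [← hRdef] at q
      have hXR : R / 4 ≤ ‖1 - herm z w‖ := by linarith
      have hd : 1 - ‖z‖ ^ 2 ≤ 4 * δ := by
        have := one_sub_sq_le' hz1 hζ
        linarith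
      have hlow : ‖1 - herm z w‖ / 2 ≤ √(trid z w) := by
        apply Real.le_sqrt_of_sq_le
        unfold trid
        have : (1 - ‖z‖ ^ 2) * (1 - ‖w‖ ^ 2) ≤ (4 * δ) * (2 * R) := by
          gcongr
        have h3 : (R / 4) ^ 2 ≤ ‖1 - herm z w‖ ^ 2 := by gcongr
        nlinarith
      have hup : √(trid z w) ≤ ‖1 - herm z w‖ := by
        rw [Real.sqrt_le_left hX.le]; exact trid_le hz1 hw
      have h1 : √(trid z w) ^ c ≤ 2 ^ |c| * ‖1 - herm z w‖ ^ c :=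
        rpow_comparable hX (by norm_num) hlow (by linarith)
      have h2 : ‖1 - herm z w‖ ^ (-(ρ + s)) ≤ (R / 4) ^ (-(ρ + s)) :=
        Real.rpow_le_rpow_of_nonpos (by positivity) hXR (by linarith)
      have h3 : (R / 4) ^ (-(ρ + s)) = 4 ^ (ρ + s) * R ^ (-(ρ + s)) := by
        rw [Real.div_rpow hR.le (by norm_num), Real.rpow_neg (by norm_num : (0:ℝ) ≤ 4)]
        field_simp
      rw [h3] at h2
      calc _ ≤ (1 - ‖z‖ ^ 2) ^ t * (2 ^ |c| * ‖1 - herm z w‖ ^ c) *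
            ‖1 - herm z w‖ ^ (-(ρ + s + c)) := by gcongr
        _ = (1 - ‖z‖ ^ 2) ^ t * 2 ^ |c| * (‖1 - herm z w‖ ^ c * ‖1 - herm z w‖ ^ (-(ρ + s + c))) := by ring
        _ = (1 - ‖z‖ ^ 2) ^ t * 2 ^ |c| * ‖1 - herm z w‖ ^ (-(ρ + s)) := by
            rw [← Real.rpow_add hX]; congr 2; ring
        _ ≤ (1 - ‖z‖ ^ 2) ^ t * 2 ^ |c| * (4 ^ (ρ + s) * R ^ (-(ρ + s))) := by gcongr
        _ = _ := by ring
    calc _ ≤ ∫⁻ z in tent ζ, ENNReal.ofReal (2 ^ |c| * 4 ^ (ρ + s) * R ^ (-(ρ + s))) *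
          ENNReal.ofReal ((1 - ‖z‖ ^ 2) ^ t) := by
          refine setLIntegral_mono' (measurableSet_tent hζ) (fun z hz => ?_)
          rw [← ENNReal.ofReal_mul (by positivity)]
          exact ENNReal.ofReal_le_ofReal (hpt z hz)
      _ = ENNReal.ofReal (2 ^ |c| * 4 ^ (ρ + s) * R ^ (-(ρ + s))) * ∫⁻ z in tent ζ,
          ENNReal.ofReal ((1 - ‖z‖ ^ 2) ^ t) := lintegral_const_mul' _ _ ENNReal.ofReal_ne_top
      _ ≤ ENNReal.ofReal (2 ^ |c| * 4 ^ (ρ + s) * R ^ (-(ρ + s))) *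
          ENNReal.ofReal (C2 * (2 * δ) ^ ρ) := by gcongr
      _ ≤ _ := by
        rw [← ENNReal.ofReal_mul (by positivity)]
        apply ENNReal.ofReal_le_ofReal
        have h1 : R ^ (-s) ≤ 2 ^ s * D ^ (-s) := by
          have : R ^ (-s) ≤ (D / 2) ^ (-s) :=
            Real.rpow_le_rpow_of_nonpos (by positivity) (by linarith) (by linarith)
          refine this.trans (le_of_eq ?_)
          rw [Real.div_rpow hD.le (by norm_num), Real.rpow_neg (by norm_num : (0:ℝ) ≤ 2)]
          field_simp
        calc _ = 2 ^ |c| * 4 ^ (ρ + s) * C2 * 2 ^ ρ * R ^ (-s) * (δ / R) ^ ρ := by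
              rw [Real.mul_rpow (by norm_num) hδ.le, Real.div_rpow hδ.le hR.le, neg_add,
                Real.rpow_add hR, Real.rpow_neg hR.le ρ]
              field_simp
          _ ≤ 2 ^ |c| * 4 ^ (ρ + s) * C2 * 2 ^ ρ * (2 ^ s * D ^ (-s)) * (δ / R) ^ ρ := by gcongr
          _ = (2 ^ |c| * 4 ^ (ρ + s) * C2 * 2 ^ ρ * 2 ^ s) * D ^ (-s) * (δ / R) ^ ρ := by ring
          _ ≤ _ := by
            gcongr
            exact le_add_of_nonneg_left (by positivity)

theorem ae_lambda_ball (n : ℕ) : ∀ᵐ z ∂(lambdaM n), z ∈ ball (0 : En n) 1 :=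
  (withDensity_absolutelyContinuous _ _).ae_le (ae_restrict_mem measurableSet_ball)

theorem carleson_ball {n : ℕ} (h : En n → ℝ≥0∞) {ζ : En n} (hζ : ‖ζ‖ < 1)
    (hζ0 : ζ ≠ 0) (r : ℝ) (hr : 1 - ‖ζ‖ ≤ r) :
    ∫⁻ w in {w | ‖1 - herm w ζ‖ < r}, h w ^ 2 ∂(lambdaM n) ≤
      cmSqE h * ENNReal.ofReal (r ^ (n : ℝ)) := by
  have hζn : 0 < ‖ζ‖ := norm_pos_iff.2 hζ0
  have hr0 : 0 < r := by linarith
  have step : ∀ ζ' : En n, ‖ζ'‖ < 1 → ζ' ≠ 0 → (1 - ‖ζ'‖) ≤ r →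
      (∀ w ∈ ball (0 : En n) 1, ‖1 - herm w ζ‖ < r → w ∈ tent ζ') →
      ∫⁻ w in {w | ‖1 - herm w ζ‖ < r}, h w ^ 2 ∂(lambdaM n) ≤
      cmSqE h * ENNReal.ofReal (r ^ (n : ℝ)) := by
    intro ζ' h1 h2 h3 h4
    have hle : (ENNReal.ofReal ((1 - ‖ζ'‖) ^ n))⁻¹ * ∫⁻ z in tent ζ', (h z) ^ 2 ∂(lambdaM n) ≤
        cmSqE h := by
      unfold cmSqE
      exact le_iSup₂_of_le ζ' ⟨by simpa using h1, by simpa using h2⟩ le_rfl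
    have hpos : 0 < (1 - ‖ζ'‖) ^ n := by
      have : 0 < 1 - ‖ζ'‖ := by linarith
      positivity
    rw [mul_comm, ← div_eq_mul_inv, ENNReal.div_le_iff (by simpa using hpos) ENNReal.ofReal_ne_top] at hle
    calc _ ≤ ∫⁻ z in tent ζ', (h z) ^ 2 ∂(lambdaM n) := by
          apply lintegral_mono_set'
          filter_upwards [ae_lambda_ball n] with w hw hw2
          exact h4 w hw hw2
      _ ≤ _ := hle
      _ ≤ _ := by
          rw [Real.rpow_natCast]
          gcongr
  have hsm : ∀ (k : ℝ), 0 ≤ k → ‖(k / ‖ζ‖) • ζ‖ = k := by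
    intro k hk
    rw [norm_smul, Real.norm_of_nonneg (by positivity), div_mul_cancel₀ _ hζn.ne']
  have hhm : ∀ (k : ℝ) (w : En n), herm w ((k / ‖ζ‖) • ζ) = ((k / ‖ζ‖ : ℝ) : ℂ) * herm w ζ := by
    intro k w
    simp only [herm, Finset.mul_sum, PiLp.smul_apply, Complex.real_smul, map_mul, Complex.conj_ofReal]
    exact Finset.sum_congr rfl fun i _ => by ring
  rcases lt_or_ge r 1 with h1 | h1
  · have hn1 := hsm (1 - r) (by linarith)
    refine step (((1 - r) / ‖ζ‖) • ζ) (by rw [hn1]; linarith) ?_ (by rw [hn1]; linarith) ?_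
    · rw [← norm_pos_iff, hn1]; linarith
    · intro w hw hw2
      rw [mem_ball_zero_iff] at hw
      rw [mem_tent (by rw [hn1]; linarith)]
      refine ⟨hw, ?_⟩
      rw [hn1, hhm]
      have e : 1 - (((1 - r) / ‖ζ‖ : ℝ) : ℂ) * herm w ζ = (1 - herm w ζ) +
          ((1 - (1 - r) / ‖ζ‖ : ℝ) : ℂ) * herm w ζ := by push_cast; ring
      have h3 : 0 ≤ 1 - (1 - r) / ‖ζ‖ := by
        rw [sub_nonneg, div_le_one hζn]; linarith
      have h4 : ‖((1 - (1 - r) / ‖ζ‖ : ℝ) : ℂ) * herm w ζ‖ ≤ r := by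
        rw [norm_mul, Complex.norm_real, Real.norm_of_nonneg h3]
        have h5 := norm_herm_le w ζ
        have h6 : ‖herm w ζ‖ ≤ ‖ζ‖ := by nlinarith
        calc _ ≤ (1 - (1 - r) / ‖ζ‖) * ‖ζ‖ := by gcongr
          _ = ‖ζ‖ - (1 - r) := by field_simp
          _ ≤ r := by linarith
      rw [e]
      have := norm_add_le (1 - herm w ζ) (((1 - (1 - r) / ‖ζ‖ : ℝ) : ℂ) * herm w ζ)
      linarith
  · have hn1 := hsm (1/4) (by norm_num)
    refine step (((1/4) / ‖ζ‖) • ζ) (by rw [hn1]; norm_num) ?_ (by rw [hn1]; linarith) ?_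
    · rw [← norm_pos_iff, hn1]; norm_num
    · intro w hw _
      rw [mem_ball_zero_iff] at hw
      rw [mem_tent (by rw [hn1]; norm_num)]
      refine ⟨hw, ?_⟩
      have h5 := norm_herm_le w (((1/4) / ‖ζ‖) • ζ)
      rw [hn1] at h5 ⊢
      have := norm_sub_le (1:ℂ) (herm w (((1/4) / ‖ζ‖) • ζ))
      simp only [norm_one] at this
      linarith

theorem carleson_weighted (n : ℕ) (ρ : ℝ) (hρ : (n:ℝ) < ρ) : ∃ C : ℝ, 0 < C ∧
    ∀ h : En n → ℝ≥0∞, Measurable h → ∀ ζ : En n, ‖ζ‖ < 1 → ζ ≠ 0 →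
      ∫⁻ w, h w ^ 2 * ENNReal.ofReal (‖1 - herm w ζ‖ ^ (-ρ)) ∂(lambdaM n) ≤
        cmSqE h * ENNReal.ofReal (C * (1 - ‖ζ‖) ^ ((n:ℝ) - ρ)) := by
  have h1 : (2:ℝ) ^ ((n:ℝ) - ρ) < 1 :=
    Real.rpow_lt_one_of_one_lt_of_neg (by norm_num) (by linarith)
  refine ⟨(2:ℝ) ^ (n:ℝ) / (1 - (2:ℝ) ^ ((n:ℝ) - ρ)), div_pos (by positivity) (by linarith), ?_⟩
  intro h hh ζ hζ hζ0
  have hXm : Measurable fun w : En n => ‖1 - herm w ζ‖ := by fun_prop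
  have := dyadic_up ((lambdaM n).withDensity fun w => h w ^ 2) (fun w => ‖1 - herm w ζ‖) hXm
    (δ := 1 - ‖ζ‖) (m := (n:ℝ)) (q := ρ) (by linarith) hρ
    (by have : (0:ℝ) ≤ n := by positivity
        linarith) (cmSqE h) ?_ ?_
  · rwa [lintegral_withDensity_eq_lintegral_mul _ (by fun_prop) (by fun_prop)] at this
  · refine (withDensity_absolutelyContinuous _ _).ae_le ?_
    filter_upwards [ae_lambda_ball n] with z hz
    rw [mem_ball_zero_iff] at hz
    exact one_sub_norm_le hz
  · intro r hr
    rw [withDensity_apply _ (measurableSet_lt hXm measurable_const)]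
    exact carleson_ball h hζ hζ0 r hr

theorem schur_cs {α : Type*} [MeasurableSpace α] (μ : Measure α) (k q h : α → ℝ≥0∞)
    (hk : Measurable k) (hq : Measurable q) (hh : Measurable h)
    (hq0 : ∀ᵐ x ∂μ, q x ≠ 0 ∧ q x ≠ ⊤) :
    (∫⁻ x, k x * h x ∂μ) ^ 2 ≤ (∫⁻ x, k x * q x ∂μ) * ∫⁻ x, k x * (h x ^ 2 * (q x)⁻¹) ∂μ := by
  have H := ENNReal.lintegral_mul_le_Lp_mul_Lq μ (p := 2) (q := 2) Real.HolderConjugate.two_two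
    (f := fun x => (k x * q x) ^ (1/2 : ℝ)) (g := fun x => (k x * (h x ^ 2 * (q x)⁻¹)) ^ (1/2 : ℝ))
    (by fun_prop) (by fun_prop)
  have e : ∀ x : ℝ≥0∞, (x ^ (1/2 : ℝ)) ^ (2:ℝ) = x := by
    intro x; rw [← ENNReal.rpow_mul]; norm_num
  simp only [e] at H
  have e2 : ∫⁻ x, k x * h x ∂μ = ∫⁻ x, ((fun x => (k x * q x) ^ (1/2 : ℝ)) *
      (fun x => (k x * (h x ^ 2 * (q x)⁻¹)) ^ (1/2 : ℝ))) x ∂μ := by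
    apply lintegral_congr_ae
    filter_upwards [hq0] with x hx
    simp only [Pi.mul_apply]
    rw [← ENNReal.mul_rpow_of_nonneg _ _ (by norm_num)]
    have : k x * q x * (k x * (h x ^ 2 * (q x)⁻¹)) = (k x * h x) ^ (2:ℝ) * (q x * (q x)⁻¹) := by
      rw [ENNReal.rpow_two]; ring
    rw [this, ENNReal.mul_inv_cancel hx.1 hx.2, mul_one, ← ENNReal.rpow_mul]; norm_num
  rw [e2]
  calc _ ≤ _ := pow_le_pow_left' H 2
    _ = _ := by rw [mul_pow, ← ENNReal.rpow_two, ← ENNReal.rpow_two, e, e]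

set_option maxHeartbeats 1000000 in
theorem main_sq (n : ℕ) (hn : 1 ≤ n) (a b c : ℝ)
    (hc : -2 * (n : ℝ) < c) (ha : -2 * a < -(n : ℝ)) (hb : -(n : ℝ) < 2 * (b + 1)) :
    ∃ C : ℝ, 0 < C ∧ ∀ h : En n → ℝ≥0∞, Measurable h →
        cmSqE (Tabc a b c h) ≤ ENNReal.ofReal C * cmSqE h := by
  obtain ⟨C1, hC1, H1⟩ := FR n hn (b + n / 2) (a - n / 2) c (by linarith) (by linarith) hc
  obtain ⟨C2, hC2, H2⟩ := J_bound n hn (a - n / 2 - 1) (b + 1 + n / 2) c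
    (by linarith) (by linarith) hc
  obtain ⟨C3, hC3, H3⟩ := carleson_weighted n (a + n / 2) (by linarith)
  refine ⟨C1 * C2 * C3, by positivity, ?_⟩
  intro h hh
  set K : En n → En n → ℝ≥0∞ := fun z w => ENNReal.ofReal
      ((1 - ‖z‖ ^ 2) ^ a * (1 - ‖w‖ ^ 2) ^ b * Real.sqrt (trid w z) ^ c *
        ‖1 - herm z w‖ ^ (-((n : ℝ) + 1 + a + b + c))) with hK
  have hKm : Measurable (Function.uncurry K) := by
    simp only [hK, Function.uncurry_def]
    fun_prop
  set q : En n → ℝ≥0∞ := fun w => ENNReal.ofReal ((1 - ‖w‖ ^ 2) ^ ((n:ℝ) / 2)) with hq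
  have hqm : Measurable q := by
    simp only [hq]
    fun_prop
  set B : Measure (En n) := (volume : Measure (En n)).restrict (ball (0 : En n) 1) with hB
  have hBae : ∀ᵐ w ∂B, ‖w‖ < 1 := by
    filter_upwards [ae_restrict_mem measurableSet_ball] with w hw
    simpa using hw
  have hT : ∀ z, Tabc a b c h z = ∫⁻ w, K z w * h w ∂B := fun z => rfl
  have hTm : Measurable (Tabc a b c h) := by
    have e : Tabc a b c h = fun z => ∫⁻ w, K z w * h w ∂B := funext hT
    rw [e]
    exact Measurable.lintegral_prod_right' (f := fun p : En n × En n => K p.1 p.2 * h p.2)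
      (hKm.mul (hh.comp measurable_snd))
  have step1 : ∀ z : En n, ‖z‖ < 1 → ∫⁻ w, K z w * q w ∂B ≤
      ENNReal.ofReal (C1 * (1 - ‖z‖ ^ 2) ^ ((n:ℝ) / 2)) := by
    intro z hz
    have hz' := one_sub_sq_pos hz
    calc ∫⁻ w, K z w * q w ∂B = ∫⁻ w, ENNReal.ofReal ((1 - ‖z‖ ^ 2) ^ a) *
          ENNReal.ofReal ((1 - ‖w‖ ^ 2) ^ (b + (n:ℝ) / 2) * √(trid w z) ^ c *
          ‖1 - herm w z‖ ^ (-((n:ℝ) + 1 + (b + n / 2) + (a - n / 2) + c))) ∂B := by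
          apply lintegral_congr_ae
          filter_upwards [hBae] with w hw
          have hw' := one_sub_sq_pos hw
          simp only [hK, hq]
          rw [← ENNReal.ofReal_mul (by positivity), ← ENNReal.ofReal_mul (by positivity),
            Real.rpow_add hw', norm_herm_comm z w,
            show (n:ℝ) + 1 + (b + n / 2) + (a - n / 2) + c = n + 1 + a + b + c by ring]
          congr 1
          ring
      _ = ENNReal.ofReal ((1 - ‖z‖ ^ 2) ^ a) * ∫⁻ w, 
          ENNReal.ofReal ((1 - ‖w‖ ^ 2) ^ (b + (n:ℝ) / 2) * √(trid w z) ^ c *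
          ‖1 - herm w z‖ ^ (-((n:ℝ) + 1 + (b + n / 2) + (a - n / 2) + c))) ∂B :=
          lintegral_const_mul' _ _ ENNReal.ofReal_ne_top
      _ ≤ ENNReal.ofReal ((1 - ‖z‖ ^ 2) ^ a) *
          ENNReal.ofReal (C1 * (1 - ‖z‖ ^ 2) ^ (-(a - (n:ℝ) / 2))) := by
          gcongr
          exact H1 z hz
      _ = _ := by
          rw [← ENNReal.ofReal_mul (by positivity)]
          congr 1
          rw [mul_left_comm, ← Real.rpow_add hz']
          congr 2
          ring
  have hq0 : ∀ᵐ w ∂B, q w ≠ 0 ∧ q w ≠ ⊤ := by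
    filter_upwards [hBae] with w hw
    have hw' := one_sub_sq_pos hw
    refine ⟨?_, ENNReal.ofReal_ne_top⟩
    have : 0 < (1 - ‖w‖ ^ 2) ^ ((n:ℝ) / 2) := by positivity
    simpa [hq] using this
  have step2 : ∀ z : En n, ‖z‖ < 1 → (Tabc a b c h z) ^ 2 ≤
      ENNReal.ofReal (C1 * (1 - ‖z‖ ^ 2) ^ ((n:ℝ) / 2)) *
        ∫⁻ w, K z w * (h w ^ 2 * (q w)⁻¹) ∂B := by
    intro z hz
    rw [hT]
    have hKz : Measurable (K z) := by
      simp only [hK]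
      fun_prop
    refine (schur_cs B (K z) q h hKz hqm hh hq0).trans ?_
    gcongr
    exact step1 z hz
  have hden : Measurable fun z : En n => ENNReal.ofReal ((1 - ‖z‖ ^ 2) ^ (-(n : ℝ) - 1)) := by
    fun_prop
  unfold cmSqE
  refine iSup₂_le fun ζ hζ0 => ?_
  obtain ⟨hζ, hζne⟩ := hζ0
  rw [mem_ball_zero_iff] at hζ
  have hζne : ζ ≠ 0 := by simpa using hζne
  have hδ : 0 < 1 - ‖ζ‖ := by linarith
  set δ := 1 - ‖ζ‖ with hδdef
  have hBtent : B.restrict (tent ζ) = (volume : Measure (En n)).restrict (tent ζ) := by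
    rw [hB, Measure.restrict_restrict (measurableSet_tent hζ), inter_eq_self_of_subset_left]
    intro z hz
    rw [mem_ball_zero_iff]
    exact ((mem_tent hζ).1 hz).1
  set G : En n → En n → ℝ≥0∞ := fun z w =>
    ENNReal.ofReal (C1 * (1 - ‖z‖ ^ 2) ^ (-(n:ℝ) / 2 - 1)) * (K z w * (h w ^ 2 * (q w)⁻¹)) with hG
  have hGm : Measurable (Function.uncurry G) := by
    have e : Function.uncurry G = fun p : En n × En n =>
      ENNReal.ofReal (C1 * (1 - ‖p.1‖ ^ 2) ^ (-(n:ℝ) / 2 - 1)) *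
        (Function.uncurry K p * (h p.2 ^ 2 * (q p.2)⁻¹)) := rfl
    rw [e]
    fun_prop
  have step3 : ∫⁻ z in tent ζ, (Tabc a b c h z) ^ 2 ∂(lambdaM n) ≤
      ∫⁻ z in tent ζ, ∫⁻ w, G z w ∂B := by
    unfold lambdaM
    rw [setLIntegral_withDensity_eq_setLIntegral_mul _ hden (hTm.pow_const 2)
      (measurableSet_tent hζ), ← hB, hBtent]
    refine setLIntegral_mono' (measurableSet_tent hζ) fun z hz => ?_
    have hz1 := ((mem_tent hζ).1 hz).1
    have hz' := one_sub_sq_pos hz1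
    simp only [Pi.mul_apply, hG]
    rw [lintegral_const_mul' _ _ ENNReal.ofReal_ne_top]
    calc _ ≤ ENNReal.ofReal ((1 - ‖z‖ ^ 2) ^ (-(n : ℝ) - 1)) *
        (ENNReal.ofReal (C1 * (1 - ‖z‖ ^ 2) ^ ((n:ℝ) / 2)) *
        ∫⁻ w, K z w * (h w ^ 2 * (q w)⁻¹) ∂B) := by
          gcongr
          exact step2 z hz1
      _ = _ := by
          rw [← mul_assoc, ← ENNReal.ofReal_mul (by positivity)]
          congr 2
          rw [mul_left_comm, ← Real.rpow_add hz']
          congr 2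
          ring
  have step4 : ∀ w : En n, ‖w‖ < 1 → ∫⁻ z in tent ζ, G z w ≤
      ENNReal.ofReal (C1 * C2 * δ ^ (a + (n:ℝ) / 2)) *
        (ENNReal.ofReal ((1 - ‖w‖ ^ 2) ^ (-(n:ℝ) - 1)) *
          (h w ^ 2 * ENNReal.ofReal (‖1 - herm w ζ‖ ^ (-(a + (n:ℝ) / 2))))) := by
    intro w hw
    have hw' := one_sub_sq_pos hw
    have hR := X_pos hw hζ
    have hqi : (q w)⁻¹ = ENNReal.ofReal ((1 - ‖w‖ ^ 2) ^ (-((n:ℝ) / 2))) := by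
      simp only [hq]
      rw [← ENNReal.ofReal_inv_of_pos (by positivity), Real.rpow_neg hw'.le]
    calc ∫⁻ z in tent ζ, G z w = ∫⁻ z in tent ζ,
          ENNReal.ofReal ((1 - ‖z‖ ^ 2) ^ (a - (n:ℝ) / 2 - 1) * √(trid z w) ^ c *
            ‖1 - herm z w‖ ^ (-((n:ℝ) + 1 + (a - n / 2 - 1) + (b + 1 + n / 2) + c))) *
          (ENNReal.ofReal (C1 * (1 - ‖w‖ ^ 2) ^ (b - (n:ℝ) / 2)) * h w ^ 2) := by
          refine setLIntegral_congr_fun (measurableSet_tent hζ) fun z hz => ?_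
          have hz1 := ((mem_tent hζ).1 hz).1
          have hz' := one_sub_sq_pos hz1
          simp only [hG, hK, hqi]
          have e : ∀ x y z t : ℝ≥0∞, x * (y * (z * t)) = x * y * t * z := by
            intros; ring
          rw [e, ← mul_assoc, ← ENNReal.ofReal_mul (by positivity),
            ← ENNReal.ofReal_mul (by positivity), ← ENNReal.ofReal_mul (by positivity)]
          congr 2
          rw [trid_comm w z,
            show (n:ℝ) + 1 + (a - n / 2 - 1) + (b + 1 + n / 2) + c = n + 1 + a + b + c by ring,
            show a - (n:ℝ) / 2 - 1 = (-(n:ℝ) / 2 - 1) + a by ring, Real.rpow_add hz',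
            show b - (n:ℝ) / 2 = b + -((n:ℝ) / 2) by ring, Real.rpow_add hw']
          ring
      _ = (∫⁻ z in tent ζ,
          ENNReal.ofReal ((1 - ‖z‖ ^ 2) ^ (a - (n:ℝ) / 2 - 1) * √(trid z w) ^ c *
            ‖1 - herm z w‖ ^ (-((n:ℝ) + 1 + (a - n / 2 - 1) + (b + 1 + n / 2) + c)))) *
          (ENNReal.ofReal (C1 * (1 - ‖w‖ ^ 2) ^ (b - (n:ℝ) / 2)) * h w ^ 2) :=
          lintegral_mul_const _ (by fun_prop)
      _ ≤ ENNReal.ofReal (C2 * (1 - ‖w‖ ^ 2) ^ (-(b + 1 + (n:ℝ) / 2)) *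
          (δ / ‖1 - herm w ζ‖) ^ ((n:ℝ) + 1 + (a - n / 2 - 1))) *
          (ENNReal.ofReal (C1 * (1 - ‖w‖ ^ 2) ^ (b - (n:ℝ) / 2)) * h w ^ 2) := by
          gcongr
          exact H2 w ζ hw hζ
      _ = _ := by
          have e : ∀ x y z t : ℝ≥0∞, x * (y * (z * t)) = x * y * t * z := by
            intros; ring
          rw [e, ← mul_assoc, ← ENNReal.ofReal_mul (by positivity),
            ← ENNReal.ofReal_mul (by positivity), ← ENNReal.ofReal_mul (by positivity)]
          congr 2
          rw [show (n:ℝ) + 1 + (a - n / 2 - 1) = a + n / 2 by ring,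
            Real.div_rpow hδ.le hR.le, Real.rpow_neg hR.le,
            show -(n:ℝ) - 1 = (-(b + 1 + (n:ℝ) / 2)) + (b - (n:ℝ) / 2) by ring,
            Real.rpow_add hw']
          ring
  have step5 : ∫⁻ z in tent ζ, ∫⁻ w, G z w ∂B ≤
      ENNReal.ofReal (C1 * C2 * δ ^ (a + (n:ℝ) / 2)) *
        (cmSqE h * ENNReal.ofReal (C3 * δ ^ ((n:ℝ) - (a + (n:ℝ) / 2)))) := by
    rw [lintegral_lintegral_swap hGm.aemeasurable]
    calc _ ≤ ∫⁻ w, ENNReal.ofReal (C1 * C2 * δ ^ (a + (n:ℝ) / 2)) *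
        (ENNReal.ofReal ((1 - ‖w‖ ^ 2) ^ (-(n:ℝ) - 1)) *
          (h w ^ 2 * ENNReal.ofReal (‖1 - herm w ζ‖ ^ (-(a + (n:ℝ) / 2))))) ∂B := by
          apply lintegral_mono_ae
          filter_upwards [hBae] with w hw
          exact step4 w hw
      _ = ENNReal.ofReal (C1 * C2 * δ ^ (a + (n:ℝ) / 2)) *
          ∫⁻ w, h w ^ 2 * ENNReal.ofReal (‖1 - herm w ζ‖ ^ (-(a + (n:ℝ) / 2))) ∂(lambdaM n) := by
          rw [lintegral_const_mul' _ _ ENNReal.ofReal_ne_top]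
          unfold lambdaM
          rw [lintegral_withDensity_eq_lintegral_mul _ hden (by fun_prop)]
          rfl
      _ ≤ _ := by
          gcongr
          exact H3 h hh ζ hζ hζne
  rw [mul_comm, ← div_eq_mul_inv, ENNReal.div_le_iff (by simpa using pow_pos hδ n) ENNReal.ofReal_ne_top]
  refine (step3.trans step5).trans (le_of_eq ?_)
  change _ = ENNReal.ofReal (C1 * C2 * C3) * cmSqE h * _
  rw [mul_left_comm, mul_comm (ENNReal.ofReal (C1 * C2 * C3)), mul_assoc (cmSqE h),
    ← ENNReal.ofReal_mul (by positivity), ← ENNReal.ofReal_mul (by positivity)]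
  congr 2
  rw [← Real.rpow_natCast, show δ ^ (n:ℝ) = δ ^ (a + (n:ℝ) / 2) * δ ^ ((n:ℝ) - (a + (n:ℝ) / 2)) by
    rw [← Real.rpow_add hδ]; congr 1; ring]
  ring

/-- **Lemma (Schur-type estimate in `CM(B_n)`)**: if `c > -2n` and `-2a < -n < 2(b+1)` then
`T_{a,b,c}` is bounded on `CM(B_n)`. -/
theorem Tabc_bounded_on_CM (n : ℕ) (hn : 1 ≤ n) (a b c : ℝ)
    (hc : -2 * (n : ℝ) < c) (ha : -2 * a < -(n : ℝ)) (hb : -(n : ℝ) < 2 * (b + 1)) :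
    ∃ C : ℝ, 0 < C ∧
      ∀ h : En n → ℝ≥0∞, Measurable h →
        (cmSqE (Tabc a b c h)) ^ (1 / 2 : ℝ) ≤
          ENNReal.ofReal C * (cmSqE h) ^ (1 / 2 : ℝ) := by
  obtain ⟨C, hC, H⟩ := main_sq n hn a b c hc ha hb
  refine ⟨C ^ (1 / 2 : ℝ), by positivity, fun h hh => ?_⟩
  rw [← ENNReal.ofReal_rpow_of_pos hC, ← ENNReal.mul_rpow_of_nonneg _ _ (by norm_num)]
  exact ENNReal.rpow_le_rpow (H h hh) (by norm_num)
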